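/- SLNR–RZF equivalence: the unit-norm SLNR precoder w_SLNR = (I + H_{-k} H_{-k}^H)^{-1} h_k / ‖(I + H_{-k} H_{-k}^H)^{-1} h_k‖ equals the unit-norm RZF precoder w_RZF = (I + H H^H)^{-1} h_k / ‖(I + H H^H)^{-1} h_k‖, provided h_k ≠ 0. -/

import Mathlib

open Matrix
open scoped ComplexOrder

noncomputable def enorm {n : ℕ} (v : Fin n → ℂ) : ℝ := Real.sqrt (∑ i, ‖v i‖ ^ 2)

theorem slnr_enorm_smul {n : ℕ} (r : ℝ) (hr : 0 < r) (v : Fin n → ℂ) :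
    Real.sqrt (∑ i, ‖((r : ℂ) • v) i‖ ^ 2) = r * Real.sqrt (∑ i, ‖v i‖ ^ 2) := by
  have h : ∑ i, ‖((r : ℂ) • v) i‖ ^ 2 = r ^ 2 * ∑ i, ‖v i‖ ^ 2 := by
    rw [Finset.mul_sum]
    refine Finset.sum_congr rfl fun i _ => ?_
    rw [Pi.smul_apply, norm_smul, mul_pow, Complex.norm_real, Real.norm_of_nonneg hr.le]
  rw [h, Real.sqrt_mul (sq_nonneg r), Real.sqrt_sq hr.le]

theorem slnr_posDef {n : ℕ} {m : Type*} [Fintype m] (A : Matrix (Fin n) m ℂ) :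
    (1 + A * Aᴴ).PosDef :=
  Matrix.PosDef.one.add_posSemidef (Matrix.posSemidef_self_mul_conjTranspose A)

/-- SLNR–RZF equivalence: the unit-norm SLNR precoder equals the unit-norm
RZF precoder. -/
theorem slnr_eq_rzf {n K : ℕ} (H : Matrix (Fin n) (Fin K) ℂ) (k : Fin K)
    (hk0 : (fun i => H i k) ≠ 0) :
    let hk : Fin n → ℂ := fun i => H i k
    let Hm := H.submatrix id (fun j : {j : Fin K // j ≠ k} => (j : Fin K))
    let B := (1 : Matrix (Fin n) (Fin n) ℂ) + Hm * Hmᴴ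
    let C := (1 : Matrix (Fin n) (Fin n) ℂ) + H * Hᴴ
    ((enorm (B⁻¹ *ᵥ hk) : ℂ))⁻¹ • (B⁻¹ *ᵥ hk) =
      ((enorm (C⁻¹ *ᵥ hk) : ℂ))⁻¹ • (C⁻¹ *ᵥ hk) := by
  intro hk Hm B C
  have hB : B.PosDef := slnr_posDef Hm
  have hC : C.PosDef := slnr_posDef H
  have hBu : IsUnit B.det := (Matrix.isUnit_iff_isUnit_det B).1 hB.isUnit
  have hCu : IsUnit C.det := (Matrix.isUnit_iff_isUnit_det C).1 hC.isUnit
  have hCB : C = B + Matrix.vecMulVec hk (star hk) := by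
    ext i j
    simp only [C, B, Hm, hk, Matrix.add_apply, Matrix.mul_apply, Matrix.vecMulVec_apply,
      Matrix.submatrix_apply, Matrix.conjTranspose_apply, id, Pi.star_apply, add_assoc]
    congr 1
    rw [Fintype.sum_eq_add_sum_subtype_ne _ k, add_comm]
  obtain ⟨t, ht0, ht⟩ : ∃ t : ℝ, 0 ≤ t ∧ star hk ⬝ᵥ (B⁻¹ *ᵥ hk) = (t : ℂ) := by
    have h := hB.inv.posSemidef.dotProduct_mulVec_nonneg hk
    obtain ⟨h1, h2⟩ := Complex.le_def.1 h
    exact ⟨_, h1, Complex.ext rfl (by simpa using h2.symm)⟩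
  have hCb : C *ᵥ (B⁻¹ *ᵥ hk) = ((1 + t : ℝ) : ℂ) • hk := by
    rw [hCB, Matrix.add_mulVec, Matrix.mulVec_mulVec, Matrix.mul_nonsing_inv _ hBu,
      Matrix.one_mulVec, Matrix.vecMulVec_mulVec, ht]
    ext i
    simp
    ring
  have hpos : 0 < 1 + t := by linarith
  have hne : ((1 + t : ℝ) : ℂ) ≠ 0 := by exact_mod_cast hpos.ne'
  have key : B⁻¹ *ᵥ hk = ((1 + t : ℝ) : ℂ) • (C⁻¹ *ᵥ hk) := by
    rw [← Matrix.mulVec_smul, ← hCb, Matrix.mulVec_mulVec, Matrix.nonsing_inv_mul _ hCu,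
      Matrix.one_mulVec]
  rw [key]
  unfold _root_.enorm
  rw [slnr_enorm_smul _ hpos, smul_smul, Complex.ofReal_mul, mul_inv, mul_right_comm,
    inv_mul_cancel₀ hne, one_mul]
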